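/- Let S be a nonempty compact subset of ℝ^d, let c_1, …, c_n ∈ ℝ^d with n ≥ 1, and let R_1, …, R_L be a partition of the index set {1, …, n} into nonempty leaves. For each leaf l, let c̄_l = (1/|R_l|) ∑_{i ∈ R_l} c_i, and assume W*(c̄_l) is a singleton. Then the total SPO training loss under leafwise-optimal predictions satisfies ∑_{l=1}^L inf_{ĉ ∈ ℝ^d} ∑_{i ∈ R_l} ℓ_SPO(ĉ, c_i) = ∑_{l=1}^L ( min_{w ∈ S} ∑_{i ∈ R_l} ⟪c_i, w⟫ ) − ∑_{i=1}^n z*(c_i). -/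

import Mathlib

open scoped RealInnerProductSpace

/-- `zStar S c = min_{w ∈ S} ⟪c, w⟫`, the optimal value of the decision problem. -/
noncomputable def zStar {d : ℕ} (S : Set (EuclideanSpace ℝ (Fin d)))
    (c : EuclideanSpace ℝ (Fin d)) : ℝ :=
  sInf ((fun w => ⟪c, w⟫) '' S)

/-- `WStar S c` is the set of optimal decisions for cost vector `c`. -/
def WStar {d : ℕ} (S : Set (EuclideanSpace ℝ (Fin d)))
    (c : EuclideanSpace ℝ (Fin d)) : Set (EuclideanSpace ℝ (Fin d)) :=
  {w ∈ S | ⟪c, w⟫ = zStar S c}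

/-- The SPO loss `ℓ_SPO(ĉ, c) = max_{w ∈ W*(ĉ)} ⟪c, w⟫ − z*(c)`. -/
noncomputable def spoLoss {d : ℕ} (S : Set (EuclideanSpace ℝ (Fin d)))
    (chat c : EuclideanSpace ℝ (Fin d)) : ℝ :=
  sSup ((fun w => ⟪c, w⟫) '' WStar S chat) - zStar S c

section SPO

variable {d : ℕ} {S : Set (EuclideanSpace ℝ (Fin d))}

theorem isLeast_zStar (hS : IsCompact S) (hSne : S.Nonempty) (c : EuclideanSpace ℝ (Fin d)) :
    IsLeast ((fun w => ⟪c, w⟫) '' S) (zStar S c) :=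
  (hS.image (by fun_prop)).isLeast_sInf (hSne.image _)

theorem WStar_nonempty (hS : IsCompact S) (hSne : S.Nonempty) (c : EuclideanSpace ℝ (Fin d)) :
    (WStar S c).Nonempty :=
  (isLeast_zStar hS hSne c).1

theorem inner_sub_zStar_le_spoLoss (hS : IsCompact S) {chat w : EuclideanSpace ℝ (Fin d)}
    (hw : w ∈ WStar S chat) (c : EuclideanSpace ℝ (Fin d)) :
    ⟪c, w⟫ - zStar S c ≤ spoLoss S chat c := by
  have hbdd : BddAbove ((fun w => ⟪c, w⟫) '' WStar S chat) :=
    (hS.image (by fun_prop)).bddAbove.mono (Set.image_mono fun _ hx => hx.1)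
  exact sub_le_sub_right (le_csSup hbdd (Set.mem_image_of_mem _ hw)) _

theorem spoLoss_eq_of_WStar_eq_singleton {chat w : EuclideanSpace ℝ (Fin d)}
    (hw : WStar S chat = {w}) (c : EuclideanSpace ℝ (Fin d)) :
    spoLoss S chat c = ⟪c, w⟫ - zStar S c := by
  simp [spoLoss, hw]

/-- If the mean cost vector has a unique optimal decision, then the best constant prediction
incurs the minimum total cost minus the sum of the optimal costs. -/
theorem sInf_sum_spoLoss {ι : Type*} (hS : IsCompact S) (hSne : S.Nonempty)
    (c : ι → EuclideanSpace ℝ (Fin d)) {s : Finset ι} (hs : s.Nonempty)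
    (hsing : ∃ w, WStar S ((s.card : ℝ)⁻¹ • ∑ i ∈ s, c i) = {w}) :
    sInf (Set.range fun chat => ∑ i ∈ s, spoLoss S chat (c i))
      = sInf ((fun w => ∑ i ∈ s, ⟪c i, w⟫) '' S) - ∑ i ∈ s, zStar S (c i) := by
  obtain ⟨w₀, hw₀⟩ := hsing
  have hmem : w₀ ∈ WStar S ((s.card : ℝ)⁻¹ • ∑ i ∈ s, c i) := by simp [hw₀]
  have hpos : (0 : ℝ) < (s.card : ℝ)⁻¹ := by
    have := hs.card_pos
    positivity
  have hmin : ∀ w ∈ S, ∑ i ∈ s, ⟪c i, w₀⟫ ≤ ∑ i ∈ s, ⟪c i, w⟫ := by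
    intro w hw
    have h := (isLeast_zStar hS hSne ((s.card : ℝ)⁻¹ • ∑ i ∈ s, c i)).2
      (Set.mem_image_of_mem _ hw)
    rw [← hmem.2] at h
    simp only [real_inner_smul_left, sum_inner] at h
    exact le_of_mul_le_mul_left h hpos
  have hleast : IsLeast ((fun w => ∑ i ∈ s, ⟪c i, w⟫) '' S) (∑ i ∈ s, ⟪c i, w₀⟫) :=
    ⟨⟨w₀, hmem.1, rfl⟩, Set.forall_mem_image.2 hmin⟩
  rw [hleast.csInf_eq, ← Finset.sum_sub_distrib]
  refine IsLeast.csInf_eq ⟨⟨_, Finset.sum_congr rfl fun i _ =>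
    spoLoss_eq_of_WStar_eq_singleton hw₀ (c i)⟩, Set.forall_mem_range.2 fun chat => ?_⟩
  obtain ⟨w, hw⟩ := WStar_nonempty hS hSne chat
  calc ∑ i ∈ s, (⟪c i, w₀⟫ - zStar S (c i))
      ≤ ∑ i ∈ s, (⟪c i, w⟫ - zStar S (c i)) := by
        simpa only [Finset.sum_sub_distrib] using sub_le_sub_right (hmin w hw.1) _
    _ ≤ ∑ i ∈ s, spoLoss S chat (c i) :=
        Finset.sum_le_sum fun i _ => inner_sub_zStar_le_spoLoss hS hw (c i)

end SPO

/-- The total SPO training loss under leafwise-optimal predictions equals the sum, over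
leaves, of minimum total leaf costs, minus the sum of the optimal costs. -/
theorem total_spo_training_loss {d n L : ℕ} (S : Set (EuclideanSpace ℝ (Fin d)))
    (hS : IsCompact S) (hSne : S.Nonempty) (hn : 1 ≤ n)
    (c : Fin n → EuclideanSpace ℝ (Fin d))
    (R : Fin L → Finset (Fin n))
    (hRne : ∀ l, (R l).Nonempty)
    (hRdisj : ∀ l l', l ≠ l' → Disjoint (R l) (R l'))
    (hRcover : ∀ i, ∃ l, i ∈ R l)
    (cbar : Fin L → EuclideanSpace ℝ (Fin d))
    (hcbar : ∀ l, cbar l = ((R l).card : ℝ)⁻¹ • ∑ i ∈ R l, c i)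
    (hsing : ∀ l, ∃ w, WStar S (cbar l) = {w}) :
    ∑ l, sInf (Set.range fun chat => ∑ i ∈ R l, spoLoss S chat (c i))
      = ∑ l, sInf ((fun w => ∑ i ∈ R l, ⟪c i, w⟫) '' S) - ∑ i, zStar S (c i) := by
  have hpart : ∑ i, zStar S (c i) = ∑ l, ∑ i ∈ R l, zStar S (c i) := by
    rw [← Finset.sum_biUnion fun l _ l' _ h => hRdisj l l' h]
    congr 1
    ext i
    simpa using hRcover i
  rw [hpart, ← Finset.sum_sub_distrib]
  exact Finset.sum_congr rfl fun l _ =>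
    sInf_sum_spoLoss hS hSne c (hRne l) (hcbar l ▸ hsing l)
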